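/- Fix n ∈ ℕ. For m ∈ ℕ let P_{n,m} : ℂ → ℂ be the function P_{n,m} = (z − ∂_{z̄})^m (w ↦ conj(w)^n). Then for all Z, z ∈ ℂ the series Σ_{m=0}^{∞} (Z^m/m!) · P_{n,m}(z) converges absolutely and equals (conj(z) − Z)^n · e^{Z·z}. (This identifies the guiding-center coherent state in the n-th Landau level, stripped of Gaussian factors, as c_n (z̄ − Z)^n e^{Zz}.) -/

import Mathlib

noncomputable section

/-- Wirtinger derivative `∂_{z̄} F = ½(∂_x F + i ∂_y F)`. -/
def dzbar (F : ℂ → ℂ) (z : ℂ) : ℂ :=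
  (1 / 2 : ℂ) * (fderiv ℝ F z 1 + Complex.I * fderiv ℝ F z Complex.I)

/-- The operator `z − ∂_{z̄}`, sending `F` to `z ↦ z · F z − (∂_{z̄} F) z`. -/
def Sop (F : ℂ → ℂ) : ℂ → ℂ := fun z => z * F z - dzbar F z

open scoped ContDiff

lemma contDiff_dzbar {F : ℂ → ℂ} (hF : ContDiff ℝ ∞ F) : ContDiff ℝ ∞ (dzbar F) := by
  have h : ContDiff ℝ ∞ (fderiv ℝ F) := hF.fderiv_right (by simp)
  unfold dzbar
  fun_prop

lemma contDiff_Sop {F : ℂ → ℂ} (hF : ContDiff ℝ ∞ F) : ContDiff ℝ ∞ (Sop F) :=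
  (contDiff_id.mul hF).sub (contDiff_dzbar hF)

lemma contDiff_Sop_iterate {F : ℂ → ℂ} (hF : ContDiff ℝ ∞ F) (m : ℕ) :
    ContDiff ℝ ∞ (Sop^[m] F) := by
  induction m with
  | zero => exact hF
  | succ m ih => rw [Function.iterate_succ_apply']; exact contDiff_Sop ih

lemma contDiff_starRingEnd_pow (n : ℕ) :
    ContDiff ℝ ∞ (fun w : ℂ => (starRingEnd ℂ) w ^ n) :=
  Complex.conjCLE.contDiff.pow n

/-- The operator `z − ∂_{z̄}` applied to a combination `conj · A − c B`. -/
lemma Sop_conj_mul_sub {A B : ℂ → ℂ} (hA : Differentiable ℝ A) (hB : Differentiable ℝ B)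
    (c : ℂ) :
    Sop (fun w => (starRingEnd ℂ) w * A w - c * B w) =
      fun w => (starRingEnd ℂ) w * Sop A w - A w - c * Sop B w := by
  funext w
  have h := (Complex.conjCLE.hasFDerivAt.mul (hA w).hasFDerivAt).sub
    ((hB w).hasFDerivAt.const_mul c)
  have h' : fderiv ℝ (fun w => (starRingEnd ℂ) w * A w - c * B w) w = _ := h.fderiv
  simp only [Sop, dzbar, h']
  simp
  linear_combination (A w / 2) * Complex.I_mul_I

/-- The commutation relation `[(z − ∂_{z̄})^m, conj] = −m (z − ∂_{z̄})^(m-1)`. -/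
lemma Sop_iterate_conj_mul {F : ℂ → ℂ} (hF : ContDiff ℝ ∞ F) (m : ℕ) :
    Sop^[m] (fun w => (starRingEnd ℂ) w * F w) =
      fun w => (starRingEnd ℂ) w * (Sop^[m] F) w - m * (Sop^[m - 1] F) w := by
  induction m with
  | zero => simp
  | succ m ih =>
    have hd (k : ℕ) : Differentiable ℝ (Sop^[k] F) :=
      (contDiff_Sop_iterate hF k).differentiable (by simp)
    rw [Function.iterate_succ_apply', ih, Sop_conj_mul_sub (hd _) (hd _)]
    funext w
    cases m with
    | zero => simp
    | succ k =>
      simp only [Nat.add_sub_cancel, ← Function.iterate_succ_apply' Sop]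
      push_cast
      ring

lemma Sop_iterate_one (m : ℕ) : Sop^[m] (fun _ => 1) = fun w => w ^ m := by
  induction m with
  | zero => simp
  | succ m ih =>
    rw [Function.iterate_succ_apply', ih]
    funext w
    have h : fderiv ℝ (fun w : ℂ => w ^ m) w = _ :=
      ((hasDerivAt_pow m w).hasFDerivAt.restrictScalars ℝ).fderiv
    simp only [Sop, dzbar, h]
    simp
    linear_combination (-(m * w ^ (m - 1)) / 2) * Complex.I_mul_I

lemma hasSum_Sop_iterate_conj_pow (n : ℕ) (Z z : ℂ) :
    HasSum (fun m : ℕ =>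
        Z ^ m / (m.factorial : ℂ) * (Sop^[m] (fun w => (starRingEnd ℂ) w ^ n)) z)
      (((starRingEnd ℂ) z - Z) ^ n * Complex.exp (Z * z)) := by
  induction n with
  | zero =>
    simp only [pow_zero, Sop_iterate_one, one_mul, Complex.exp_eq_exp_ℂ]
    refine (NormedSpace.expSeries_div_hasSum_exp (Z * z)).congr_fun fun m => ?_
    rw [mul_pow]
    ring
  | succ n ih =>
    have hshift : HasSum (fun m : ℕ => Z ^ m / (m.factorial : ℂ) *
        (m * (Sop^[m - 1] (fun w => (starRingEnd ℂ) w ^ n)) z))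
        (Z * (((starRingEnd ℂ) z - Z) ^ n * Complex.exp (Z * z))) := by
      rw [← hasSum_nat_add_iff' 1]
      simp only [Finset.range_one, Finset.sum_singleton, Nat.cast_zero, zero_mul, mul_zero,
        sub_zero]
      refine (ih.mul_left Z).congr_fun fun m => ?_
      have : (m.factorial : ℂ) ≠ 0 := mod_cast m.factorial_ne_zero
      have : (m + 1 : ℂ) ≠ 0 := mod_cast m.succ_ne_zero
      rw [Nat.factorial_succ, Nat.add_sub_cancel]
      push_cast
      field_simp
      ring
    rw [pow_succ', mul_assoc, sub_mul]
    refine ((ih.mul_left ((starRingEnd ℂ) z)).sub hshift).congr_fun fun m => ?_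
    simp only [pow_succ' _ n, Sop_iterate_conj_mul (contDiff_starRingEnd_pow n)]
    ring

/-- with `P_{n,m} = (z − ∂_{z̄})^m (w ↦ conj(w)^n)`, for all `Z, z ∈ ℂ`
the series `Σ_m (Z^m/m!) P_{n,m}(z)` converges absolutely with sum
`(conj z − Z)^n e^{Zz}` (the guiding-center coherent state stripped of Gaussians). -/
theorem stmt9 (n : ℕ) (Z z : ℂ) :
    Summable (fun m : ℕ =>
      ‖Z ^ m / (m.factorial : ℂ) * (Sop^[m] (fun w => (starRingEnd ℂ) w ^ n)) z‖) ∧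
    HasSum (fun m : ℕ =>
        Z ^ m / (m.factorial : ℂ) * (Sop^[m] (fun w => (starRingEnd ℂ) w ^ n)) z)
      (((starRingEnd ℂ) z - Z) ^ n * Complex.exp (Z * z)) :=
  ⟨(hasSum_Sop_iterate_conj_pow n Z z).summable.norm, hasSum_Sop_iterate_conj_pow n Z z⟩
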